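/- arXiv:1802.05297 — 4 statements merged into one kernel-verified Lean document; each statement's English description precedes it below -/
import Mathlib

section
/- Let K_1, …, K_m be nonempty compact convex subsets of ℝ^n. If every choice of points x_1 ∈ K_1, …, x_m ∈ K_m forms an affinely independent family, then for every subset I ⊆ {1,…,m} the convex hulls conv(⋃_{i∈I} K_i) and conv(⋃_{j∉I} K_j) are disjoint. -/
/-- A point of the convex hull of a union of nonempty convex sets, indexed by part of a finite type,
is a convex combination of one point from each set. -/
theorem exists_weights_of_mem_convexHull_biUnion {ι E : Type*} [Fintype ι] [AddCommGroup E]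
    [Module ℝ E] {K : ι → Set E} (hne : ∀ i, (K i).Nonempty) (hconv : ∀ i, Convex ℝ (K i))
    {I : Set ι} {p : E} (hp : p ∈ convexHull ℝ (⋃ i ∈ I, K i)) :
    ∃ (w : ι → ℝ) (x : ι → E), (∀ i, 0 ≤ w i) ∧ (∀ i ∉ I, w i = 0) ∧ ∑ i, w i = 1 ∧
      (∀ i, x i ∈ K i) ∧ ∑ i, w i • x i = p := by
  classical
  refine convexHull_min (t := {p | ∃ (w : ι → ℝ) (x : ι → E), (∀ i, 0 ≤ w i) ∧
    (∀ i ∉ I, w i = 0) ∧ ∑ i, w i = 1 ∧ (∀ i, x i ∈ K i) ∧ ∑ i, w i • x i = p}) ?_ ?_ hp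
  · intro q hq
    simp only [Set.mem_iUnion] at hq
    obtain ⟨i, hi, hq⟩ := hq
    choose c hc using hne
    refine ⟨Pi.single i 1, Function.update c i q, fun j => ?_, fun j hj => ?_, ?_,
      fun j => ?_, ?_⟩
    · rcases eq_or_ne j i with rfl | h <;> simp [*]
    · exact Pi.single_eq_of_ne (ne_of_mem_of_not_mem hi hj).symm _
    · simp
    · rcases eq_or_ne j i with rfl | h <;> simp [*]
    · rw [Finset.sum_eq_single i] <;> simp +contextual
  · rintro _ ⟨w, x, hw, hwI, hw1, hx, rfl⟩ _ ⟨v, y, hv, hvI, hv1, hy, rfl⟩ a b ha hb hab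
    choose z hz hzeq using fun i => (hconv i).exists_mem_add_smul_eq (hx i) (hy i)
      (mul_nonneg ha (hw i)) (mul_nonneg hb (hv i))
    refine ⟨fun i => a * w i + b * v i, z, fun i => ?_, fun i hi => ?_, ?_, hz, ?_⟩
    · exact add_nonneg (mul_nonneg ha (hw i)) (mul_nonneg hb (hv i))
    · simp [hwI i hi, hvI i hi]
    · rw [Finset.sum_add_distrib, ← Finset.mul_sum, ← Finset.mul_sum, hw1, hv1]
      simpa using hab
    · simp only [hzeq, Finset.sum_add_distrib, Finset.smul_sum, mul_smul]

/-- Let `K 1, …, K m` be nonempty compact convex subsets of `ℝ^n`.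
If every choice of points `x i ∈ K i` forms an affinely independent family, then for
every subset `I ⊆ {1,…,m}` the convex hulls `conv(⋃_{i∈I} K i)` and
`conv(⋃_{j∉I} K j)` are disjoint. -/
theorem totally_real_theta.strongly_separated_of_affineIndependent
    (n m : ℕ) (K : Fin m → Set (Fin n → ℝ))
    (hne : ∀ i, (K i).Nonempty)
    (hcomp : ∀ i, IsCompact (K i))
    (hconv : ∀ i, Convex ℝ (K i))
    (hind : ∀ x : Fin m → (Fin n → ℝ), (∀ i, x i ∈ K i) → AffineIndependent ℝ x) :
    ∀ I : Set (Fin m),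
      Disjoint (convexHull ℝ (⋃ i ∈ I, K i)) (convexHull ℝ (⋃ i ∈ Iᶜ, K i)) := by
  classical
  intro I
  rw [Set.disjoint_left]
  intro p hp hq
  obtain ⟨w, x, -, hwI, hw1, hx, hwp⟩ := exists_weights_of_mem_convexHull_biUnion hne hconv hp
  obtain ⟨v, y, -, hvI, hv1, hy, hvp⟩ := exists_weights_of_mem_convexHull_biUnion hne hconv hq
  have hz := hind (fun i => if i ∈ I then x i else y i) fun i => by
    split_ifs
    exacts [hx i, hy i]
  have hterm : ∀ i, (w i - v i) • (if i ∈ I then x i else y i) = w i • x i - v i • y i := by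
    intro i
    by_cases hi : i ∈ I
    · simp [hi, hvI i (not_not_intro hi)]
    · simp [hi, hwI i hi]
  have heq := affineIndependent_iff.1 hz Finset.univ (fun i => w i - v i)
    (by simp [hw1, hv1]) (by simp only [hterm, Finset.sum_sub_distrib, hwp, hvp, sub_self])
  have hw0 : ∀ i, w i = 0 := by
    intro i
    by_cases hi : i ∈ I
    · rw [sub_eq_zero.1 (heq i (Finset.mem_univ i)), hvI i (not_not_intro hi)]
    · exact hwI i hi
  simp [hw0] at hw1
end

section
/- Let K_1, …, K_n ⊆ ℝ^n be strongly separated convex bodies with n ≥ 2, and let u ∈ K_n. Then there exists an affine hyperplane H ⊆ ℝ^n with u ∉ H such that for each i = 1, …, n−1 and each x ∈ K_i the line through u and x meets H in exactly one point π(x), and the images π(K_1), …, π(K_{n−1}) are strongly separated convex bodies in H (identifying H with ℝ^{n−1}). -/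
/-- The radial projection from `u` onto the affine hyperplane `{y | φ y = φ u + 1}`. -/
noncomputable def centralProjection {E : Type*} [AddCommGroup E] [Module ℝ E]
    (φ : E →ₗ[ℝ] ℝ) (u x : E) : E :=
  AffineMap.lineMap u x (φ (x - u))⁻¹

section CentralProjection

variable {E : Type*} [AddCommGroup E] [Module ℝ E] {φ : E →ₗ[ℝ] ℝ} {u : E}

theorem centralProjection_eq (x : E) :
    centralProjection φ u x = (φ (x - u))⁻¹ • (x - u) + u := by
  simp [centralProjection, AffineMap.lineMap_apply]

theorem map_centralProjection {x : E} (hx : φ (x - u) ≠ 0) :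
    φ (centralProjection φ u x) = φ u + 1 := by
  rw [centralProjection_eq, map_add, map_smul, smul_eq_mul, inv_mul_cancel₀ hx, add_comm]

theorem eq_centralProjection_of_map_lineMap {x : E} (t : ℝ)
    (ht : φ (AffineMap.lineMap u x t) = φ u + 1) :
    AffineMap.lineMap u x t = centralProjection φ u x := by
  have h : t * φ (x - u) = 1 := by
    simp only [AffineMap.lineMap_apply, vsub_eq_sub, vadd_eq_add, map_add, map_smul,
      smul_eq_mul] at ht
    linarith
  rw [centralProjection, eq_inv_of_mul_eq_one_left h]

theorem centralProjection_lineMap {y : E} (hy : φ y = φ u + 1) {s : ℝ} (hs : s ≠ 0) :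
    centralProjection φ u (AffineMap.lineMap u y s) = y := by
  have h : φ (y - u) = 1 := by rw [map_sub, hy]; ring
  simp [centralProjection_eq, AffineMap.lineMap_apply, h, -map_sub, smul_smul, hs]

theorem lineMap_centralProjection {x : E} (hx : φ (x - u) ≠ 0) :
    AffineMap.lineMap u (centralProjection φ u x) (φ (x - u)) = x := by
  simp [centralProjection_eq, AffineMap.lineMap_apply, -map_sub, smul_smul, hx]

theorem Convex.image_centralProjection {K : Set E} (hK : Convex ℝ K)
    (hpos : ∀ x ∈ K, 0 < φ (x - u)) : Convex ℝ (centralProjection φ u '' K) := by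
  rintro _ ⟨x, hx, rfl⟩ _ ⟨y, hy, rfl⟩ a b ha hb hab
  have hx0 := hpos x hx
  have hy0 := hpos y hy
  obtain ⟨z, hz, hpq⟩ := hK.exists_mem_add_smul_eq hx hy
    (div_nonneg ha hx0.le) (div_nonneg hb hy0.le)
  set p := a / φ (x - u) with hp
  set q := b / φ (y - u) with hq
  have hsub : (p + q) • (z - u) = p • (x - u) + q • (y - u) := by
    rw [smul_sub, hpq]; module
  have hφ : (p + q) * φ (z - u) = 1 := by
    have h := congrArg φ hsub
    simp only [map_add, map_smul, smul_eq_mul] at h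
    rw [h, hp, hq, div_mul_cancel₀ _ hx0.ne', div_mul_cancel₀ _ hy0.ne', hab]
  refine ⟨z, hz, ?_⟩
  rw [centralProjection_eq, ← eq_inv_of_mul_eq_one_left hφ, hsub, centralProjection_eq,
    centralProjection_eq, hp, hq, smul_add, smul_add, smul_smul, smul_smul,
    div_eq_mul_inv, div_eq_mul_inv]
  obtain rfl : b = 1 - a := by linarith
  module

theorem LinearIndependent.affineIndependent_centralProjection {ι : Type*} {x : ι → E}
    (hx : LinearIndependent ℝ fun i => x i - u) (hne : ∀ i, φ (x i - u) ≠ 0) :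
    AffineIndependent ℝ fun i => centralProjection φ u (x i) := by
  have hli := hx.units_smul fun i => (Units.mk0 _ (hne i))⁻¹
  rw [affineIndependent_iff]
  intro s w hw hsum
  refine linearIndependent_iff'.mp hli s w ?_
  simp only [centralProjection_eq, smul_add, Finset.sum_add_distrib, ← Finset.sum_smul, hw,
    zero_smul, add_zero] at hsum
  exact hsum

end CentralProjection

section Normed

variable {E : Type*} [NormedAddCommGroup E] [NormedSpace ℝ E]

theorem IsCompact.image_centralProjection {φ : E →L[ℝ] ℝ} {u : E} {K : Set E}
    (hK : IsCompact K) (hne : ∀ x ∈ K, φ (x - u) ≠ 0) :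
    IsCompact (centralProjection (φ : E →ₗ[ℝ] ℝ) u '' K) := by
  refine hK.image_of_continuousOn ?_
  have h : centralProjection (φ : E →ₗ[ℝ] ℝ) u = fun x => (φ (x - u))⁻¹ • (x - u) + u :=
    funext centralProjection_eq
  rw [h]
  exact ((ContinuousOn.inv₀ (by fun_prop) hne).smul (by fun_prop)).add continuousOn_const

theorem interior_image_centralProjection_nonempty {φ : E →ₗ[ℝ] ℝ} {u : E} {K : Set E}
    (hK : (interior K).Nonempty) (hne : ∀ x ∈ K, φ (x - u) ≠ 0) :
    (interior {y : {y | φ y = φ u + 1} |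
      (y : E) ∈ centralProjection φ u '' K}).Nonempty := by
  obtain ⟨x, hx⟩ := hK
  have hx0 := hne x (interior_subset hx)
  refine ⟨⟨centralProjection φ u x, map_centralProjection hx0⟩, ?_⟩
  rw [mem_interior]
  refine ⟨(fun y => AffineMap.lineMap u (y : E) (φ (x - u))) ⁻¹' interior K, ?_, ?_, ?_⟩
  · intro y hy
    exact ⟨_, interior_subset hy, centralProjection_lineMap y.2 hx0⟩
  · refine isOpen_interior.preimage ?_
    simp only [AffineMap.lineMap_apply, vsub_eq_sub, vadd_eq_add]
    fun_prop
  · rw [Set.mem_preimage, lineMap_centralProjection hx0]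
    exact hx

/-- The convex hull of finitely many nonempty convex sets consists of the convex combinations of
one point from each set. -/
theorem convexHull_iUnion_eq_image_stdSimplex_prod {ι : Type*} [Fintype ι] {K : ι → Set E}
    (hconv : ∀ i, Convex ℝ (K i)) (hne : ∀ i, (K i).Nonempty) :
    convexHull ℝ (⋃ i, K i) = (fun p : (ι → ℝ) × (ι → E) => ∑ i, p.1 i • p.2 i) ''
      (stdSimplex ℝ ι ×ˢ Set.univ.pi K) := by
  classical
  refine (convexHull_min (Set.iUnion_subset fun i v hv => ?_) ?_).antisymm ?_
  · choose x hx using hne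
    refine ⟨(Pi.single i 1, Function.update x i v),
      ⟨single_mem_stdSimplex ℝ i, fun j _ => ?_⟩, ?_⟩
    · obtain rfl | h := eq_or_ne j i
      · simpa using hv
      · simpa [h] using hx j
    · dsimp only
      rw [Finset.sum_eq_single i] <;> simp +contextual
  · rintro _ ⟨⟨w, x⟩, ⟨hw, hx⟩, rfl⟩ _ ⟨⟨w', x'⟩, ⟨hw', hx'⟩, rfl⟩ a b ha hb hab
    choose z hz hzeq using fun i => (hconv i).exists_mem_add_smul_eq
      (hx i (Set.mem_univ i)) (hx' i (Set.mem_univ i))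
      (mul_nonneg ha (hw.1 i)) (mul_nonneg hb (hw'.1 i))
    refine ⟨(fun i => a * w i + b * w' i, z),
      ⟨convex_stdSimplex ℝ ι hw hw' ha hb hab, fun i _ => hz i⟩, ?_⟩
    simp only [hzeq, Finset.sum_add_distrib, mul_smul, Finset.smul_sum]
  · rintro _ ⟨⟨w, x⟩, ⟨hw, hx⟩, rfl⟩
    exact (convex_convexHull ℝ _).sum_mem (fun i _ => hw.1 i) hw.2 fun i _ =>
      subset_convexHull ℝ _ (Set.mem_iUnion_of_mem i (hx i (Set.mem_univ i)))

theorem isCompact_convexHull_iUnion {ι : Type*} [Fintype ι] {K : ι → Set E}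
    (hcomp : ∀ i, IsCompact (K i)) (hconv : ∀ i, Convex ℝ (K i)) (hne : ∀ i, (K i).Nonempty) :
    IsCompact (convexHull ℝ (⋃ i, K i)) := by
  rw [convexHull_iUnion_eq_image_stdSimplex_prod hconv hne]
  exact ((isCompact_stdSimplex ℝ ι).prod (isCompact_univ_pi hcomp)).image (by fun_prop)

theorem exists_forall_pos_of_linearIndependent {ι : Type*} [Fintype ι]
    {K : ι → Set E} {u : E} (hcomp : ∀ i, IsCompact (K i)) (hconv : ∀ i, Convex ℝ (K i))
    (hne : ∀ i, (K i).Nonempty)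
    (hli : ∀ x : ι → E, (∀ i, x i ∈ K i) → LinearIndependent ℝ fun i => x i - u) :
    ∃ φ : E →L[ℝ] ℝ, ∀ i, ∀ x ∈ K i, 0 < φ (x - u) := by
  have hu : u ∉ convexHull ℝ (⋃ i, K i) := by
    intro h
    rw [convexHull_iUnion_eq_image_stdSimplex_prod hconv hne] at h
    obtain ⟨⟨w, x⟩, ⟨⟨-, hw⟩, hx⟩, hsum⟩ := h
    dsimp only at hw hx hsum
    have h0 := Fintype.linearIndependent_iff.mp (hli x fun i => hx i (Set.mem_univ i)) w (by
      simp only [smul_sub, Finset.sum_sub_distrib, ← Finset.sum_smul, hw, hsum, one_smul,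
        sub_self])
    simp [h0] at hw
  obtain ⟨φ, c, hc, hφ⟩ := geometric_hahn_banach_point_closed (convex_convexHull ℝ (⋃ i, K i))
    (isCompact_convexHull_iUnion hcomp hconv hne).isClosed hu
  refine ⟨φ, fun i x hx => ?_⟩
  have := hφ x (subset_convexHull ℝ _ (Set.mem_iUnion_of_mem i hx))
  rw [map_sub]
  linarith

end Normed

theorem AffineIndependent.linearIndependent_sub_of_snoc {E : Type*} [AddCommGroup E]
    [Module ℝ E] {m : ℕ} {x : Fin m → E} {u : E}
    (h : AffineIndependent ℝ (Fin.snoc x u : Fin (m + 1) → E)) :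
    LinearIndependent ℝ fun i => x i - u := by
  have h' := (affineIndependent_iff_linearIndependent_vsub ℝ _ (Fin.last m)).mp h
  have := h'.comp (fun i : Fin m => (⟨i.castSucc, (Fin.castSucc_lt_last i).ne⟩ :
      {j : Fin (m + 1) // j ≠ Fin.last m}))
    fun i j hij => by simpa using hij
  simpa [Function.comp_def] using this

/-- Let `K 1, …, K n ⊆ ℝ^n` be strongly separated convex bodies with
`n ≥ 2`, and let `u ∈ K n`. Then there is an affine hyperplane `H ⊆ ℝ^n` with `u ∉ H`
such that for each `i = 1, …, n−1` and each `x ∈ K i` the line through `u` and `x`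
meets `H` in exactly one point `π x`, and the images `π '' K 1, …, π '' K (n−1)` are
strongly separated convex bodies in `H` (compact, convex, contained in `H`, with
nonempty interior relative to `H`, and every choice of points from them affinely
independent). -/
theorem totally_real_theta.projection_strongly_separated
    (n : ℕ) (hn : 2 ≤ n) (K : Fin n → Set (Fin n → ℝ))
    (hcomp : ∀ i, IsCompact (K i))
    (hconv : ∀ i, Convex ℝ (K i))
    (hint : ∀ i, (interior (K i)).Nonempty)
    (hsep : ∀ x : Fin n → (Fin n → ℝ), (∀ i, x i ∈ K i) → AffineIndependent ℝ x)
    (u : Fin n → ℝ) (hu : u ∈ K ⟨n - 1, by omega⟩) :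
    ∃ (H : Set (Fin n → ℝ)) (π : (Fin n → ℝ) → (Fin n → ℝ)),
      (∃ (φ : (Fin n → ℝ) →ₗ[ℝ] ℝ) (c : ℝ), φ ≠ 0 ∧ H = {x | φ x = c}) ∧
      u ∉ H ∧
      (∀ i : Fin (n - 1), ∀ x ∈ K (Fin.castLE (by omega) i),
        π x ∈ H ∧
        (∃ t : ℝ, π x = AffineMap.lineMap u x t) ∧
        (∀ y ∈ H, (∃ t : ℝ, y = AffineMap.lineMap u x t) → y = π x)) ∧
      (∀ i : Fin (n - 1),
        IsCompact (π '' K (Fin.castLE (by omega) i)) ∧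
        Convex ℝ (π '' K (Fin.castLE (by omega) i)) ∧
        π '' K (Fin.castLE (by omega) i) ⊆ H ∧
        (interior {y : H | (y : Fin n → ℝ) ∈ π '' K (Fin.castLE (by omega) i)}).Nonempty) ∧
      (∀ y : Fin (n - 1) → (Fin n → ℝ),
        (∀ i, y i ∈ π '' K (Fin.castLE (by omega) i)) → AffineIndependent ℝ y) := by
  obtain ⟨m, rfl⟩ : ∃ m, n = m + 1 := ⟨n - 1, by omega⟩
  have hne : ∀ i : Fin m, (K i.castSucc).Nonempty := fun i => (hint _).mono interior_subset
  have hli : ∀ x : Fin m → (Fin (m + 1) → ℝ), (∀ i, x i ∈ K i.castSucc) →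
      LinearIndependent ℝ fun i => x i - u := fun x hx =>
    AffineIndependent.linearIndependent_sub_of_snoc <| hsep (Fin.snoc x u) fun i => by
      induction i using Fin.lastCases with
      | last => rw [Fin.snoc_last]; exact hu
      | cast i => simpa using hx i
  obtain ⟨φ, hφ⟩ := exists_forall_pos_of_linearIndependent
    (fun i : Fin m => hcomp i.castSucc) (fun i => hconv i.castSucc) hne hli
  have hφ0 : ∀ i : Fin m, ∀ x ∈ K i.castSucc, φ (x - u) ≠ 0 := fun i x hx => (hφ i x hx).ne'
  refine ⟨{x | φ x = φ u + 1}, centralProjection (φ : (Fin (m + 1) → ℝ) →ₗ[ℝ] ℝ) u,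
    ⟨φ, φ u + 1, ?_, rfl⟩, by simp, fun i x hx => ⟨?_, ⟨_, rfl⟩, ?_⟩,
    fun i => ⟨?_, ?_, ?_, ?_⟩, fun y hy => ?_⟩
  · intro h
    obtain ⟨x, hx⟩ := hne ⟨0, by omega⟩
    exact hφ0 _ x hx (LinearMap.congr_fun h (x - u))
  · exact map_centralProjection (hφ0 i x hx)
  · rintro _ hy ⟨t, rfl⟩
    exact eq_centralProjection_of_map_lineMap t hy
  · exact (hcomp _).image_centralProjection (hφ0 i)
  · exact (hconv _).image_centralProjection (hφ i)
  · rintro _ ⟨x, hx, rfl⟩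
    exact map_centralProjection (hφ0 i x hx)
  · exact interior_image_centralProjection_nonempty (hint _) (hφ0 i)
  · choose x hx hxy using hy
    obtain rfl := funext hxy
    exact (hli x hx).affineIndependent_centralProjection fun i => hφ0 i _ (hx i)
end

section
/- Let g ≥ 1 and 1 ≤ s ≤ g+1 with r = g+1−s even. Let H be the g×g matrix over 𝔽₂ that is block diagonal with r/2 copies of the 2×2 block H₀ = [[0,1],[1,0]] in the upper left, followed by zeros (so H·v = 0 holds if and only if the first r coordinates of v vanish, and the diagonal of H is the zero vector). Then the number of pairs (u, v) ∈ (𝔽₂)^g × (𝔽₂)^g satisfying H·v = 0 and uᵀv = 1 equals 2^{g−1}·(2^{s−1} − 1), and the number of such pairs satisfying H·v = 0 and uᵀv = 0 equals 2^{g−1}·(2^{s−1} + 1). -/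
namespace totally_real_theta

/-- The two values of the linear form `u ↦ uᵀv` with `v ≠ 0` are taken equally often. -/
lemma card_dotProduct_eq {ι : Type*} [Fintype ι] [DecidableEq ι] {v : ι → ZMod 2} (hv : v ≠ 0)
    (c : ZMod 2) :
    (Finset.univ.filter fun u : ι → ZMod 2 => ∑ i, u i * v i = c).card
      = 2 ^ (Fintype.card ι - 1) := by
  obtain ⟨k, hk⟩ := Function.ne_iff.mp hv
  have hk1 : v k = 1 := Fin.eq_one_of_ne_zero _ hk
  have hshift (u : ι → ZMod 2) : ∑ i, (u + Pi.single k (1 : ZMod 2) : ι → ZMod 2) i * v i = (∑ i, u i * v i) + 1 := by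
    simp [add_mul, Finset.sum_add_distrib, Pi.single_apply, hk1]
  have heq : (Finset.univ.filter fun u : ι → ZMod 2 => ∑ i, u i * v i = c).card
      = (Finset.univ.filter fun u : ι → ZMod 2 => ¬ ∑ i, u i * v i = c).card := by
    refine Finset.card_equiv (Equiv.addRight (Pi.single k 1)) fun u => ?_
    simp only [Finset.mem_filter, Finset.mem_univ, true_and, Equiv.coe_addRight, hshift]
    generalize ∑ i, u i * v i = a
    revert a c
    decide
  have htotal := Finset.card_filter_add_card_filter_not (s := Finset.univ)
    (fun u : ι → ZMod 2 => ∑ i, u i * v i = c)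
  have hpos : 0 < Fintype.card ι := Fintype.card_pos_iff.mpr ⟨k⟩
  rw [← heq, Finset.card_univ, Fintype.card_fun, ZMod.card,
    ← Nat.sub_add_cancel hpos, pow_succ] at htotal
  simp only [Nat.succ_eq_add_one, zero_add] at htotal
  omega

/-- Number of pairs `(u, v)` with `v ∈ K` and `uᵀv = c`, where `0 ∈ K`. -/
lemma card_pairs_dotProduct_eq {ι : Type*} [Fintype ι] [DecidableEq ι]
    (K : Finset (ι → ZMod 2)) (hK : 0 ∈ K) (c : ZMod 2) :
    (Finset.univ.filter fun p : (ι → ZMod 2) × (ι → ZMod 2) =>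
        p.2 ∈ K ∧ ∑ i, p.1 i * p.2 i = c).card
      = (K.card - 1) * 2 ^ (Fintype.card ι - 1)
        + if c = 0 then 2 ^ Fintype.card ι else 0 := by
  rw [Finset.card_eq_sum_card_fiberwise (f := Prod.snd) (t := K)
    (fun p hp => (Finset.mem_filter.mp hp).2.1)]
  have hfiber : ∀ v ∈ K, ((Finset.univ.filter fun p : (ι → ZMod 2) × (ι → ZMod 2) =>
        p.2 ∈ K ∧ ∑ i, p.1 i * p.2 i = c).filter fun p => p.2 = v).card
      = (Finset.univ.filter fun u : ι → ZMod 2 => ∑ i, u i * v i = c).card := by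
    intro v hv
    refine Finset.card_nbij' Prod.fst (fun u => (u, v)) ?_ ?_ ?_ ?_
    · rintro ⟨u, w⟩ h
      simp only [Finset.coe_filter, Finset.mem_filter, Finset.mem_univ, true_and,
        Set.mem_ofPred_eq] at h ⊢
      rw [← h.2]
      exact h.1.2
    · intro u h
      simpa [hv] using h
    · rintro ⟨u, w⟩ h
      simp only [Finset.coe_filter, Finset.mem_filter, Set.mem_ofPred_eq] at h
      simp [h.2]
    · intro u _
      rfl
  rw [Finset.sum_congr rfl hfiber, ← Finset.sum_erase_add _ _ hK,
    Finset.sum_congr rfl fun v hv => card_dotProduct_eq (Finset.ne_of_mem_erase hv) c,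
    Finset.sum_const, Finset.card_erase_of_mem hK, smul_eq_mul]
  congr 1
  by_cases hc : c = 0
  · simp [hc]
  · simp [hc, Ne.symm hc]

lemma card_filter_forall_lt_eq_zero {g r : ℕ} (hr : r ≤ g) :
    (Finset.univ.filter fun v : Fin g → ZMod 2 => ∀ i : Fin g, (i : ℕ) < r → v i = 0).card
      = 2 ^ (g - r) := by
  have hpi : (Finset.univ.filter fun v : Fin g → ZMod 2 => ∀ i : Fin g, (i : ℕ) < r → v i = 0)
      = Fintype.piFinset fun i : Fin g => if (i : ℕ) < r then {0} else Finset.univ := by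
    ext v
    simp only [Finset.mem_filter, Finset.mem_univ, true_and, Fintype.mem_piFinset]
    refine forall_congr' fun i => ?_
    split_ifs with h <;> simp [h]
  rw [hpi, Fintype.card_piFinset]
  obtain ⟨d, rfl⟩ := Nat.exists_eq_add_of_le hr
  rw [Fin.prod_univ_add]
  simp [ZMod.card]

/-- The kernel of `r / 2` hyperbolic blocks followed by zeros. -/
lemma mulVec_eq_zero_iff {g r : ℕ} (hrg : r ≤ g) (hreven : Even r)
    {H : Matrix (Fin g) (Fin g) (ZMod 2)}
    (hH : ∀ i j : Fin g, H i j =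
      if (i : ℕ) < r ∧ (j : ℕ) < r ∧ (i : ℕ) ≠ (j : ℕ) ∧ (i : ℕ) / 2 = (j : ℕ) / 2
      then 1 else 0) (v : Fin g → ZMod 2) :
    H.mulVec v = 0 ↔ ∀ i : Fin g, (i : ℕ) < r → v i = 0 := by
  constructor
  · intro h j hj
    obtain ⟨i, hi, hne, hdiv⟩ : ∃ i, i < r ∧ i ≠ (j : ℕ) ∧ i / 2 = (j : ℕ) / 2 := by
      obtain ⟨m, rfl⟩ := hreven
      rcases Nat.mod_two_eq_zero_or_one j with hj2 | hj2
      · exact ⟨j + 1, by omega, by omega, by omega⟩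
      · exact ⟨j - 1, by omega, by omega, by omega⟩
    have hrow := congrFun h ⟨i, hi.trans_le hrg⟩
    rw [Matrix.mulVec, dotProduct, Finset.sum_eq_single j] at hrow
    · simpa [hH, hi, hj, hne, hdiv] using hrow
    · intro k _ hk
      have hk' : (k : ℕ) ≠ j := Fin.val_ne_of_ne hk
      rw [hH, if_neg, zero_mul]
      rintro ⟨-, -, h1, h2⟩
      dsimp only at h1 h2
      omega
    · simp
  · intro h
    ext i
    refine Finset.sum_eq_zero (s := Finset.univ) (f := fun j => H i j * v j) fun j _ => ?_
    rw [hH]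
    split_ifs with hc
    · rw [h j hc.2.1, mul_zero]
    · rw [zero_mul]

end totally_real_theta

/-- Let `g ≥ 1`, `1 ≤ s ≤ g+1` with `r = g+1−s` even, and let `H` be
the `g×g` matrix over `𝔽₂` that is block diagonal with `r/2` copies of the block
`H₀ = [[0,1],[1,0]]` in the upper left followed by zeros (so `H i j = 1` iff
`i, j < r`, `i ≠ j` and `⌊i/2⌋ = ⌊j/2⌋`). The number of pairs `(u, v)` with
`H · v = 0` and `uᵀv = 1` equals `2^(g−1) * (2^(s−1) − 1)`, and the number with
`H · v = 0` and `uᵀv = 0` equals `2^(g−1) * (2^(s−1) + 1)`. -/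
theorem totally_real_theta.card_real_odd_even_theta_dividing
    (g s r : ℕ) (hg : 1 ≤ g) (hs1 : 1 ≤ s) (hs2 : s ≤ g + 1) (hr : r = g + 1 - s)
    (hreven : Even r)
    (H : Matrix (Fin g) (Fin g) (ZMod 2))
    (hH : ∀ i j : Fin g, H i j =
      if (i : ℕ) < r ∧ (j : ℕ) < r ∧ (i : ℕ) ≠ (j : ℕ) ∧ (i : ℕ) / 2 = (j : ℕ) / 2
      then 1 else 0) :
    (Finset.univ.filter
        (fun p : (Fin g → ZMod 2) × (Fin g → ZMod 2) =>
          H.mulVec p.2 = 0 ∧ (∑ i, p.1 i * p.2 i) = 1)).card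
      = 2 ^ (g - 1) * (2 ^ (s - 1) - 1) ∧
    (Finset.univ.filter
        (fun p : (Fin g → ZMod 2) × (Fin g → ZMod 2) =>
          H.mulVec p.2 = 0 ∧ (∑ i, p.1 i * p.2 i) = 0)).card
      = 2 ^ (g - 1) * (2 ^ (s - 1) + 1) := by
  have hrg : r ≤ g := by omega
  have hs : g - r = s - 1 := by omega
  have hcount (c : ZMod 2) := totally_real_theta.card_pairs_dotProduct_eq
    (Finset.univ.filter fun v : Fin g → ZMod 2 => ∀ i : Fin g, (i : ℕ) < r → v i = 0)
    (by simp) c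
  simp only [Finset.mem_filter, Finset.mem_univ, true_and,
    totally_real_theta.card_filter_forall_lt_eq_zero hrg, Fintype.card_fin, hs] at hcount
  simp only [totally_real_theta.mulVec_eq_zero_iff hrg hreven hH, hcount]
  refine ⟨by simp [mul_comm], ?_⟩
  obtain ⟨k, rfl⟩ := Nat.exists_eq_add_of_le' hg
  obtain ⟨m, hm⟩ := Nat.exists_eq_add_of_le' (Nat.one_le_two_pow (n := s - 1))
  simp only [hm, Nat.add_sub_cancel, if_true]
  ring
end

section
/- Let g ≥ 1 and 1 ≤ s ≤ g+1 with r = g+1−s even. Let H be the g×g matrix over 𝔽₂ that is block diagonal with r/2 copies of the 2×2 block H₀ = [[0,1],[1,0]] in the upper left, followed by zeros (so H·v = 0 holds if and only if the first r coordinates of v vanish). Fix any ε ∈ (𝔽₂)^{s−1}. If ε ≠ 0, then the number of pairs (u, v) ∈ (𝔽₂)^g × (𝔽₂)^g satisfying H·v = 0, uᵀv = 1, and u_{r+i} = ε_i for i = 1, …, s−1, equals 2^{g−1}. If ε = 0, then there are no such pairs. -/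
namespace totally_real_theta

open Finset

/-- A nonzero linear form on `𝔽₂ⁿ` takes the value `1` on exactly half of the vectors. -/
theorem card_dotProduct_eq_one {n : ℕ} {ε : Fin n → ZMod 2} (hε : ε ≠ 0) :
    #{w : Fin n → ZMod 2 | ∑ i, ε i * w i = 1} = 2 ^ (n - 1) := by
  obtain ⟨k, hk⟩ := Function.ne_iff.mp hε
  have hk1 : ε k = 1 := Fin.eq_one_of_ne_zero _ hk
  have hn : 1 ≤ n := k.pos
  have hshift (w : Fin n → ZMod 2) :
      ∑ i, ε i * (w + Pi.single k 1 : Fin n → ZMod 2) i = ∑ i, ε i * w i + 1 := by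
    simp [mul_add, sum_add_distrib, Pi.single_apply, hk1]
  have hflip : ∀ x : ZMod 2, x = 1 ↔ ¬ x + 1 = 1 := by decide
  have hcompl : #{w : Fin n → ZMod 2 | ∑ i, ε i * w i = 1} =
      #{w : Fin n → ZMod 2 | ¬ ∑ i, ε i * w i = 1} := by
    refine card_equiv (Equiv.addRight (Pi.single k 1)) fun w ↦ ?_
    simp only [mem_filter, mem_univ, true_and, Equiv.coe_addRight, hshift]
    exact hflip _
  have hadd := card_filter_add_card_filter_not (s := (univ : Finset (Fin n → ZMod 2)))
    (fun w ↦ ∑ i, ε i * w i = 1)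
  rw [← hcompl, card_univ, Fintype.card_fun, ZMod.card, Fintype.card_fin] at hadd
  obtain ⟨m, rfl⟩ : ∃ m, n = m + 1 := ⟨n - 1, by omega⟩
  rw [pow_succ] at hadd
  rw [Nat.add_sub_cancel]
  omega

/-- The kernel of a block diagonal matrix with `r / 2` hyperbolic blocks followed by zeros. -/
theorem mulVec_eq_zero_iff_of_hyperbolic {g r : ℕ} (hrg : r ≤ g) (hr : Even r)
    {H : Matrix (Fin g) (Fin g) (ZMod 2)}
    (hH : ∀ i j : Fin g, H i j =
      if (i : ℕ) < r ∧ (j : ℕ) < r ∧ (i : ℕ) ≠ (j : ℕ) ∧ (i : ℕ) / 2 = (j : ℕ) / 2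
      then 1 else 0)
    (v : Fin g → ZMod 2) :
    H.mulVec v = 0 ↔ ∀ i : Fin g, (i : ℕ) < r → v i = 0 := by
  obtain ⟨m, rfl⟩ := hr
  constructor
  · intro h i hi
    let j : Fin g := ⟨2 * (i / 2) + (1 - i % 2), by omega⟩
    have hj : (j : ℕ) = 2 * (i / 2) + (1 - i % 2) := rfl
    have hrow : H.mulVec v j = v i := by
      rw [Matrix.mulVec, dotProduct, sum_eq_single i]
      · rw [hH, if_pos (by omega), one_mul]
      · intro b _ hb
        have hb' : (b : ℕ) ≠ i := Fin.val_ne_of_ne hb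
        rw [hH, if_neg (by omega), zero_mul]
      · simp
    rw [← hrow, h, Pi.zero_apply]
  · intro h
    ext i
    rw [Matrix.mulVec, dotProduct, Pi.zero_apply]
    refine sum_eq_zero fun j _ ↦ ?_
    rw [hH]
    split_ifs with hij
    · rw [h j hij.2.1, mul_zero]
    · exact zero_mul _

/-- Splitting off the first `r` coordinates, on which `u` is free and `v` vanishes. -/
theorem card_sign_pattern_pairs (r n : ℕ) (ε : Fin n → ZMod 2) :
    #{p : (Fin (r + n) → ZMod 2) × (Fin (r + n) → ZMod 2) |
      (∀ i : Fin (r + n), (i : ℕ) < r → p.2 i = 0) ∧ ∑ i, p.1 i * p.2 i = 1 ∧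
        ∀ i : Fin n, p.1 (Fin.natAdd r i) = ε i} =
      2 ^ r * #{w : Fin n → ZMod 2 | ∑ i, ε i * w i = 1} := by
  have hcard : #(univ : Finset (Fin r → ZMod 2)) = 2 ^ r := by simp [ZMod.card]
  rw [← hcard, ← card_product]
  symm
  refine card_nbij' (fun q ↦ (Fin.append q.1 ε, Fin.append 0 q.2))
    (fun p ↦ (fun i ↦ p.1 (Fin.castAdd n i), fun i ↦ p.2 (Fin.natAdd r i))) ?_ ?_ ?_ ?_
  · rintro ⟨a, w⟩ h
    simpa [Fin.forall_fin_add, Fin.sum_univ_add] using h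
  · rintro ⟨u, v⟩ h
    simp only [coe_filter, mem_univ, true_and, Set.mem_ofPred_eq, Fin.sum_univ_add] at h
    obtain ⟨hv, hsum, hu⟩ := h
    have hv' (i : Fin r) : v (Fin.castAdd n i) = 0 := hv _ i.isLt
    simpa [hv', hu] using hsum
  · rintro ⟨a, w⟩ _
    simp
  · rintro ⟨u, v⟩ h
    simp only [coe_filter, mem_univ, true_and, Set.mem_ofPred_eq] at h
    obtain ⟨hv, -, hu⟩ := h
    refine Prod.ext ?_ ?_ <;> funext i <;> refine Fin.addCases (fun j ↦ ?_) (fun j ↦ ?_) i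
    · simp
    · simp [hu]
    · simp [hv (Fin.castAdd n j) j.isLt]
    · simp

end totally_real_theta


/-- Let `g ≥ 1`, `1 ≤ s ≤ g+1` with `r = g+1−s` even, and let `H` be
the block diagonal matrix with `r/2` copies of `H₀ = [[0,1],[1,0]]` followed by zeros.
Fix `ε ∈ 𝔽₂^(s−1)`. If `ε ≠ 0` the number of pairs `(u, v)` with `H · v = 0`,
`uᵀv = 1` and `u (r+i) = ε i` for all `i` equals `2^(g−1)`; if `ε = 0` there are no
such pairs. -/
theorem totally_real_theta.card_odd_theta_sign_pattern_dividing
    (g s r : ℕ) (hg : 1 ≤ g) (hs1 : 1 ≤ s) (hs2 : s ≤ g + 1) (hr : r = g + 1 - s)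
    (hreven : Even r)
    (H : Matrix (Fin g) (Fin g) (ZMod 2))
    (hH : ∀ i j : Fin g, H i j =
      if (i : ℕ) < r ∧ (j : ℕ) < r ∧ (i : ℕ) ≠ (j : ℕ) ∧ (i : ℕ) / 2 = (j : ℕ) / 2
      then 1 else 0)
    (ε : Fin (s - 1) → ZMod 2) :
    (ε ≠ 0 →
      (Finset.univ.filter
          (fun p : (Fin g → ZMod 2) × (Fin g → ZMod 2) =>
            H.mulVec p.2 = 0 ∧ (∑ i, p.1 i * p.2 i) = 1 ∧
            ∀ i : Fin (s - 1), p.1 ⟨r + (i : ℕ), by have := i.isLt; omega⟩ = ε i)).card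
        = 2 ^ (g - 1)) ∧
    (ε = 0 →
      (Finset.univ.filter
          (fun p : (Fin g → ZMod 2) × (Fin g → ZMod 2) =>
            H.mulVec p.2 = 0 ∧ (∑ i, p.1 i * p.2 i) = 1 ∧
            ∀ i : Fin (s - 1), p.1 ⟨r + (i : ℕ), by have := i.isLt; omega⟩ = ε i)).card
        = 0) := by
  obtain ⟨n, rfl⟩ : ∃ n, s = n + 1 := ⟨s - 1, by omega⟩
  obtain rfl : g = r + n := by omega
  simp only [totally_real_theta.mulVec_eq_zero_iff_of_hyperbolic (Nat.le_add_right r n) hreven hH]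
  have key := totally_real_theta.card_sign_pattern_pairs r n ε
  refine ⟨fun hε ↦ key.trans ?_, fun hε ↦ key.trans ?_⟩
  · have hn : 1 ≤ n := by
      obtain ⟨k, -⟩ := Function.ne_iff.mp hε
      exact k.pos
    have hcard := totally_real_theta.card_dotProduct_eq_one (n := n) hε
    rw [Nat.add_sub_assoc hn, pow_add]
    exact congrArg (2 ^ r * ·) hcard
  · subst hε
    simp
end
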